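/- arXiv:1503.03624 — 4 statements merged into one kernel-verified Lean document; each statement's English description precedes it below -/
import Mathlib

section
/- Let n ≥ 1, η > 0, c > 0, t > 0 and A, B ≥ 0. Suppose K₁, K₂ : ℝⁿ × ℝⁿ → ℂ are measurable, that sup_{x∈ℝⁿ} ∫_{ℝⁿ} |K₁(x,z)| (1 + |x-z|/t)^{n+η} dz ≤ A, and that |K₂(z,y)| ≤ B t^{-n} exp(-|z-y|/(c t)) for all z, y. Then the composed kernel K(x,y) := ∫_{ℝⁿ} K₁(x,z) K₂(z,y) dz satisfies |K(x,y)| ≤ C A B t^{-n} (1 + |x-y|/t)^{-(n+η)} for all x, y ∈ ℝⁿ, where C depends only on n, η and c. -/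
open MeasureTheory
open scoped ENNReal NNReal

/-- A power of `1 + s` is dominated by an exponential, with an explicit constant. -/
theorem one_add_rpow_mul_exp_neg_div_le {p c s : ℝ} (hp : 0 < p) (hc : 0 < c) (hs : 0 ≤ s) :
    (1 + s) ^ p * Real.exp (-s / c) ≤ (p * c) ^ p * Real.exp (1 / c) := by
  have hpc : 0 < p * c := mul_pos hp hc
  have h1 : 1 + s ≤ p * c * Real.exp ((1 + s) / (p * c)) := by
    have h := Real.add_one_le_exp ((1 + s) / (p * c))
    calc 1 + s = p * c * ((1 + s) / (p * c)) := by field_simp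
      _ ≤ _ := by gcongr; linarith
  calc (1 + s) ^ p * Real.exp (-s / c)
      ≤ (p * c * Real.exp ((1 + s) / (p * c))) ^ p * Real.exp (-s / c) := by gcongr
    _ = (p * c) ^ p * Real.exp (1 / c) := by
      rw [Real.mul_rpow hpc.le (Real.exp_pos _).le, ← Real.exp_mul, mul_assoc, ← Real.exp_add]
      congr 2
      field_simp
      ring

/-- Peetre's inequality for the weight `1 + dist x y / t`. -/
theorem one_add_dist_div_le_mul {X : Type*} [PseudoMetricSpace X] {t : ℝ} (ht : 0 < t)
    (x y z : X) : 1 + dist x y / t ≤ (1 + dist x z / t) * (1 + dist z y / t) := by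
  have h : dist x y / t ≤ dist x z / t + dist z y / t := by
    rw [← add_div]
    gcongr
    exact dist_triangle x z y
  have h' : 0 ≤ dist x z / t * (dist z y / t) := by positivity
  linarith

/-- Composition of a kernel with weighted `L¹` bounds with a kernel with exponential decay at
scale `t` yields a kernel with polynomial off-diagonal decay of order `n + η`. -/
theorem stmt2 (n : ℕ) (hn : 1 ≤ n) (η c : ℝ) (hη : 0 < η) (hc : 0 < c) :
    ∃ C : ℝ, 0 < C ∧
      ∀ t : ℝ, 0 < t → ∀ A B : ℝ, 0 ≤ A → 0 ≤ B →
        ∀ K₁ K₂ : (EuclideanSpace ℝ (Fin n)) × (EuclideanSpace ℝ (Fin n)) → ℂ,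
          Measurable K₁ → Measurable K₂ →
          (∀ x : EuclideanSpace ℝ (Fin n),
            ∫⁻ z, (‖K₁ (x, z)‖₊ : ℝ≥0∞) *
                ENNReal.ofReal ((1 + dist x z / t) ^ ((n : ℝ) + η)) ≤ ENNReal.ofReal A) →
          (∀ z y : EuclideanSpace ℝ (Fin n),
            ‖K₂ (z, y)‖ ≤ B * t ^ (-(n : ℝ)) * Real.exp (-(dist z y) / (c * t))) →
          ∀ x y : EuclideanSpace ℝ (Fin n),
            ‖∫ z, K₁ (x, z) * K₂ (z, y)‖ ≤
              C * A * B * t ^ (-(n : ℝ)) * (1 + dist x y / t) ^ (-((n : ℝ) + η)) := by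
  have hp : 0 < (n : ℝ) + η := by positivity
  refine ⟨(((n : ℝ) + η) * c) ^ ((n : ℝ) + η) * Real.exp (1 / c), by positivity, ?_⟩
  generalize (n : ℝ) + η = p at hp ⊢
  intro t ht A B hA hB K₁ K₂ _ _ h₁ h₂ x y
  set C : ℝ := (p * c) ^ p * Real.exp (1 / c) with hC
  have hC0 : 0 ≤ C := by positivity
  set D : ℝ := C * B * t ^ (-(n : ℝ)) * (1 + dist x y / t) ^ (-p) with hD
  have hD0 : 0 ≤ D := by positivity
  have decay : ∀ z, ‖K₂ (z, y)‖ ≤ (1 + dist x z / t) ^ p * D := fun z => by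
    have hw : 0 < (1 + dist x y / t) ^ p := by positivity
    have peetre : (1 + dist x y / t) ^ p ≤ (1 + dist x z / t) ^ p * (1 + dist z y / t) ^ p := by
      rw [← Real.mul_rpow (by positivity) (by positivity)]
      exact Real.rpow_le_rpow (by positivity) (one_add_dist_div_le_mul ht x y z) hp.le
    have hexp : (1 + dist z y / t) ^ p * Real.exp (-(dist z y) / (c * t)) ≤ C := by
      have h := one_add_rpow_mul_exp_neg_div_le hp hc (s := dist z y / t) (by positivity)
      rwa [show -(dist z y / t) / c = -(dist z y) / (c * t) by field_simp] at h
    have key : (1 + dist x y / t) ^ p * Real.exp (-(dist z y) / (c * t)) ≤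
        (1 + dist x z / t) ^ p * C :=
      calc _ ≤ (1 + dist x z / t) ^ p * (1 + dist z y / t) ^ p *
            Real.exp (-(dist z y) / (c * t)) := by gcongr
        _ ≤ _ := by rw [mul_assoc]; gcongr
    calc ‖K₂ (z, y)‖ ≤ B * t ^ (-(n : ℝ)) * Real.exp (-(dist z y) / (c * t)) := h₂ z y
      _ ≤ B * t ^ (-(n : ℝ)) * ((1 + dist x z / t) ^ p * C / (1 + dist x y / t) ^ p) := by
        gcongr
        rw [le_div_iff₀ hw, mul_comm]
        exact key
      _ = (1 + dist x z / t) ^ p * D := by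
        rw [hD, Real.rpow_neg (by positivity : 0 ≤ 1 + dist x y / t)]
        ring
  have bound : ‖∫ z, K₁ (x, z) * K₂ (z, y)‖ₑ ≤ ENNReal.ofReal (A * D) :=
    calc ‖∫ z, K₁ (x, z) * K₂ (z, y)‖ₑ ≤ ∫⁻ z, ‖K₁ (x, z) * K₂ (z, y)‖ₑ :=
          enorm_integral_le_lintegral_enorm _
      _ ≤ ∫⁻ z, (‖K₁ (x, z)‖₊ : ℝ≥0∞) * ENNReal.ofReal ((1 + dist x z / t) ^ p) *
            ENNReal.ofReal D := by
        refine lintegral_mono fun z => ?_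
        rw [enorm_mul, mul_assoc, ← ENNReal.ofReal_mul (by positivity), enorm_eq_nnnorm]
        gcongr
        rw [← ofReal_norm]
        exact ENNReal.ofReal_le_ofReal (decay z)
      _ = (∫⁻ z, (‖K₁ (x, z)‖₊ : ℝ≥0∞) * ENNReal.ofReal ((1 + dist x z / t) ^ p)) *
            ENNReal.ofReal D := lintegral_mul_const' _ _ ENNReal.ofReal_ne_top
      _ ≤ ENNReal.ofReal A * ENNReal.ofReal D := by gcongr; exact h₁ x
      _ = ENNReal.ofReal (A * D) := (ENNReal.ofReal_mul hA).symm
  rw [← ofReal_norm, ENNReal.ofReal_le_ofReal_iff (by positivity)] at bound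
  calc _ ≤ A * D := bound
    _ = _ := by rw [hD]; ring
end

section
/- Let n ≥ 1 and let λ, η, a be real numbers with 0 ≤ λ < η < a. Then there exists a constant C, depending only on n, λ, η and a, such that for every t > 0, every x ∈ ℝⁿ and every w ∈ ℝⁿ with |w| < t, ∫₀^∞ ∫_{ℝⁿ} min((s/t)^a, (t/s)²) · max(s,t)^η (max(s,t) + |u - w|)^{-(n+η)} (1 + |u|/s)^λ du (ds/s) ≤ C. -/
open MeasureTheory
open scoped ENNReal NNReal

section RadialDecay

variable {E : Type*} [NormedAddCommGroup E] [NormedSpace ℝ E] [FiniteDimensional ℝ E]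
  [MeasurableSpace E] [BorelSpace E] (μ : Measure E) [μ.IsAddHaarMeasure]

open Module in
/-- Scaling identity for the integral of a translated radial power. -/
theorem lintegral_add_dist_rpow_neg {r M : ℝ} (hr : (finrank ℝ E : ℝ) < r) (hM : 0 < M) (w : E) :
    ∫⁻ u, ENNReal.ofReal ((M + dist u w) ^ (-r)) ∂μ =
      ENNReal.ofReal (M ^ ((finrank ℝ E : ℝ) - r) * ∫ u, (1 + ‖u‖) ^ (-r) ∂μ) := by
  have h_int : Integrable (fun u : E ↦ (1 + ‖u‖) ^ (-r)) μ := integrable_one_add_norm hr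
  have hcomp : ∀ u : E, (M + dist u w) ^ (-r) = M ^ (-r) * (1 + ‖M⁻¹ • (u - w)‖) ^ (-r) := by
    intro u
    rw [← Real.mul_rpow hM.le (by positivity), norm_smul, dist_eq_norm, Real.norm_eq_abs,
      abs_of_pos (inv_pos.2 hM), mul_add, mul_one, mul_inv_cancel_left₀ hM.ne']
  have h_int_comp : Integrable (fun u : E ↦ M ^ (-r) * (1 + ‖M⁻¹ • (u - w)‖) ^ (-r)) μ :=
    ((h_int.comp_smul (inv_ne_zero hM.ne')).comp_sub_right w).const_mul _
  simp_rw [hcomp]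
  rw [← ofReal_integral_eq_lintegral_ofReal h_int_comp (ae_of_all _ fun u ↦ by positivity),
    integral_const_mul,
    integral_sub_right_eq_self (μ := μ) (fun u : E ↦ (1 + ‖M⁻¹ • u‖) ^ (-r)) w,
    Measure.integral_comp_inv_smul_of_nonneg μ (fun u : E ↦ (1 + ‖u‖) ^ (-r)) hM.le,
    smul_eq_mul, ← mul_assoc, ← Real.rpow_natCast, ← Real.rpow_add hM]
  congr 3
  ring

end RadialDecay

theorem one_add_div_rpow_le {s t d b l : ℝ} (hs : 0 < s) (hl : 0 ≤ l) (hd : 0 ≤ d) (hb : 0 ≤ b)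
    (hbd : b ≤ d + t) :
    (1 + b / s) ^ l ≤ (2 / s) ^ l * (max s t + d) ^ l := by
  have h1 := le_max_left s t
  have h2 := le_max_right s t
  rw [← Real.mul_rpow (by positivity) (by positivity)]
  refine Real.rpow_le_rpow (by positivity) ?_ hl
  rw [one_add_div hs.ne', div_mul_eq_mul_div]
  gcongr
  linarith

/-- The inner integral of the key estimate. -/
theorem lintegral_kernel_le (n : ℕ) {lam η : ℝ} (hlam : 0 ≤ lam) (hlη : lam < η) {s t m : ℝ}
    (hs : 0 < s) (hm : 0 ≤ m) (w : EuclideanSpace ℝ (Fin n)) (hw : ‖w‖ < t) :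
    (∫⁻ u : EuclideanSpace ℝ (Fin n), ENNReal.ofReal (m * (max s t) ^ η *
      ((max s t) + dist u w) ^ (-((n : ℝ) + η)) * (1 + ‖u‖ / s) ^ lam)) ≤
    ENNReal.ofReal (2 ^ lam *
      (∫ u : EuclideanSpace ℝ (Fin n), (1 + ‖u‖) ^ (-((n : ℝ) + η - lam))) *
        (m * (max s t / s) ^ lam)) := by
  have hM : 0 < max s t := lt_max_of_lt_left hs
  set M := max s t
  have hpt : ∀ u : EuclideanSpace ℝ (Fin n),
      ENNReal.ofReal (m * M ^ η * (M + dist u w) ^ (-((n : ℝ) + η)) * (1 + ‖u‖ / s) ^ lam) ≤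
      ENNReal.ofReal (m * M ^ η * (2 / s) ^ lam) *
        ENNReal.ofReal ((M + dist u w) ^ (-((n : ℝ) + η - lam))) := by
    intro u
    have hb : ‖u‖ ≤ dist u w + t := by
      have := norm_le_norm_sub_add u w
      rw [dist_eq_norm]
      linarith
    have hMd : 0 < M + dist u w := by positivity
    rw [← ENNReal.ofReal_mul (by positivity)]
    refine ENNReal.ofReal_le_ofReal ?_
    calc m * M ^ η * (M + dist u w) ^ (-((n : ℝ) + η)) * (1 + ‖u‖ / s) ^ lam
        ≤ m * M ^ η * (M + dist u w) ^ (-((n : ℝ) + η)) *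
            ((2 / s) ^ lam * (M + dist u w) ^ lam) := by
          gcongr
          exact one_add_div_rpow_le hs hlam dist_nonneg (norm_nonneg _) hb
      _ = m * M ^ η * (2 / s) ^ lam *
            ((M + dist u w) ^ (-((n : ℝ) + η)) * (M + dist u w) ^ lam) := by ring
      _ = _ := by
          rw [← Real.rpow_add hMd]
          congr 2
          ring
  refine (lintegral_mono hpt).trans_eq ?_
  rw [lintegral_const_mul' _ _ ENNReal.ofReal_ne_top,
    lintegral_add_dist_rpow_neg volume (by simp; linarith) hM w,
    ← ENNReal.ofReal_mul (by positivity), finrank_euclideanSpace_fin]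
  congr 1
  have hpow : M ^ η * M ^ ((n : ℝ) - (n + η - lam)) = M ^ lam := by
    rw [← Real.rpow_add hM]
    congr 1
    ring
  rw [Real.div_rpow zero_le_two hs.le, Real.div_rpow hM.le hs.le, ← hpow]
  ring

theorem setLIntegral_Ioc_rpow_sub_one {t p : ℝ} (ht : 0 < t) (hp : 0 < p) :
    ∫⁻ s in Set.Ioc 0 t, ENNReal.ofReal (s ^ (p - 1)) = ENNReal.ofReal (t ^ p / p) := by
  have h_int : IntervalIntegrable (fun s : ℝ ↦ s ^ (p - 1)) volume 0 t :=
    intervalIntegral.intervalIntegrable_rpow' (by linarith)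
  rw [← ofReal_integral_eq_lintegral_ofReal
    ((intervalIntegrable_iff_integrableOn_Ioc_of_le ht.le).1 h_int)
    (ae_restrict_of_forall_mem measurableSet_Ioc fun s hs ↦ Real.rpow_nonneg hs.1.le _),
    ← intervalIntegral.integral_of_le ht.le, integral_rpow (Or.inl (by linarith)),
    sub_add_cancel, Real.zero_rpow hp.ne', sub_zero]

theorem setLIntegral_Ioi_rpow_neg_sub_one {t p : ℝ} (ht : 0 < t) (hp : 0 < p) :
    ∫⁻ s in Set.Ioi t, ENNReal.ofReal (s ^ (-p - 1)) = ENNReal.ofReal (t ^ (-p) / p) := by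
  rw [← ofReal_integral_eq_lintegral_ofReal (integrableOn_Ioi_rpow_of_lt (by linarith) ht)
    (ae_restrict_of_forall_mem measurableSet_Ioi fun s hs ↦ Real.rpow_nonneg (ht.trans hs).le _),
    integral_Ioi_rpow_of_lt (by linarith) ht, sub_add_cancel, neg_div_neg_eq]

/-- The key estimate in the proof of the maximal-function comparison: the iterated integral of
`min((s/t)^a,(t/s)²) max(s,t)^η (max(s,t)+|u-w|)^{-(n+η)} (1+|u|/s)^λ` over `u ∈ ℝⁿ` and
`s ∈ (0,∞)` (with measure `ds/s`) is bounded uniformly in `t > 0`, `x` and `|w| < t`. -/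
theorem stmt4 (n : ℕ) (hn : 1 ≤ n) (lam η a : ℝ) (hlam : 0 ≤ lam) (hlη : lam < η)
    (hηa : η < a) :
    ∃ C : ℝ, 0 < C ∧
      ∀ t : ℝ, 0 < t → ∀ x w : EuclideanSpace ℝ (Fin n), ‖w‖ < t →
        (∫⁻ s in Set.Ioi (0 : ℝ),
            (∫⁻ u : EuclideanSpace ℝ (Fin n),
              ENNReal.ofReal (min ((s / t) ^ a) ((t / s) ^ (2 : ℝ)) *
                (max s t) ^ η * ((max s t) + dist u w) ^ (-((n : ℝ) + η)) *
                (1 + ‖u‖ / s) ^ lam)) / ENNReal.ofReal s) ≤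
          ENNReal.ofReal C := by
  set K : ℝ := 2 ^ lam *
    ∫ u : EuclideanSpace ℝ (Fin n), (1 + ‖u‖) ^ (-((n : ℝ) + η - lam))
  have hK0 : 0 ≤ K := mul_nonneg (by positivity) (integral_nonneg fun u ↦ by positivity)
  have hp : 0 < a - lam := by linarith
  refine ⟨K * (1 / (a - lam)) + K * (1 / 2) + 1, by positivity, fun t ht x w hw ↦ ?_⟩
  have hinner {s : ℝ} (hs : 0 < s) := lintegral_kernel_le n hlam hlη hs
    (le_min (Real.rpow_nonneg (div_nonneg hs.le ht.le) a)
      (Real.rpow_nonneg (div_nonneg ht.le hs.le) 2)) w hw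
  have hsmall : ∀ s ∈ Set.Ioc 0 t, (∫⁻ u : EuclideanSpace ℝ (Fin n),
      ENNReal.ofReal (min ((s / t) ^ a) ((t / s) ^ (2 : ℝ)) *
        (max s t) ^ η * ((max s t) + dist u w) ^ (-((n : ℝ) + η)) *
        (1 + ‖u‖ / s) ^ lam)) / ENNReal.ofReal s ≤
      ENNReal.ofReal (K * t ^ (-(a - lam))) * ENNReal.ofReal (s ^ (a - lam - 1)) := by
    intro s ⟨hs, hst⟩
    refine (ENNReal.div_le_div_right (hinner hs) _).trans ?_
    rw [← ENNReal.ofReal_div_of_pos hs, ← ENNReal.ofReal_mul (by positivity), max_eq_right hst]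
    refine ENNReal.ofReal_le_ofReal ?_
    calc K * (min ((s / t) ^ a) ((t / s) ^ (2 : ℝ)) * (t / s) ^ lam) / s
        ≤ K * ((s / t) ^ a * (t / s) ^ lam) / s := by
          gcongr
          exact min_le_left _ _
      _ = K * t ^ (-(a - lam)) * s ^ (a - lam - 1) := by
          rw [Real.div_rpow hs.le ht.le, Real.div_rpow ht.le hs.le, Real.rpow_neg ht.le,
            Real.rpow_sub ht, Real.rpow_sub_one hs.ne', Real.rpow_sub hs]
          field_simp
  have hlarge : ∀ s ∈ Set.Ioi t, (∫⁻ u : EuclideanSpace ℝ (Fin n),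
      ENNReal.ofReal (min ((s / t) ^ a) ((t / s) ^ (2 : ℝ)) *
        (max s t) ^ η * ((max s t) + dist u w) ^ (-((n : ℝ) + η)) *
        (1 + ‖u‖ / s) ^ lam)) / ENNReal.ofReal s ≤
      ENNReal.ofReal (K * t ^ (2 : ℝ)) * ENNReal.ofReal (s ^ (-(2 : ℝ) - 1)) := by
    intro s hst
    have hs : 0 < s := ht.trans hst
    refine (ENNReal.div_le_div_right (hinner hs) _).trans ?_
    rw [← ENNReal.ofReal_div_of_pos hs, ← ENNReal.ofReal_mul (by positivity),
      max_eq_left (le_of_lt hst), div_self hs.ne', Real.one_rpow, mul_one]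
    refine ENNReal.ofReal_le_ofReal ?_
    calc K * min ((s / t) ^ a) ((t / s) ^ (2 : ℝ)) / s
        ≤ K * (t / s) ^ (2 : ℝ) / s := by
          gcongr
          exact min_le_right _ _
      _ = K * t ^ (2 : ℝ) * s ^ (-(2 : ℝ) - 1) := by
          rw [Real.div_rpow ht.le hs.le, Real.rpow_sub_one hs.ne', Real.rpow_neg hs.le]
          field_simp
  rw [← Set.Ioc_union_Ioi_eq_Ioi ht.le]
  refine (lintegral_union_le _ _ _).trans ?_
  refine (add_le_add (setLIntegral_mono' measurableSet_Ioc hsmall)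
    (setLIntegral_mono' measurableSet_Ioi hlarge)).trans ?_
  rw [lintegral_const_mul' _ _ ENNReal.ofReal_ne_top,
    lintegral_const_mul' _ _ ENNReal.ofReal_ne_top,
    setLIntegral_Ioc_rpow_sub_one ht hp, setLIntegral_Ioi_rpow_neg_sub_one ht two_pos,
    ← ENNReal.ofReal_mul (by positivity), ← ENNReal.ofReal_mul (by positivity),
    ← ENNReal.ofReal_add (by positivity) (by positivity)]
  refine ENNReal.ofReal_le_ofReal (le_of_eq_of_le ?_ (le_add_of_nonneg_right zero_le_one))
  rw [Real.rpow_neg ht.le, Real.rpow_neg ht.le]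
  field_simp
end

section
/- Let n ≥ 1 and let η > λ ≥ 0 be real numbers. Then there exists a constant C, depending only on n, λ and η, such that for all s, t with 0 < s < t and all w ∈ ℝⁿ with |w| < t, ∫_{|u| ≥ s} t^η (t + |u - w|)^{-(n+η)} (1 + |u|/s)^λ du ≤ C (t/s)^η. -/
open MeasureTheory
open scoped ENNReal NNReal

/-- On `s ≤ ‖u‖`, the kernel is dominated by a rescaled Japanese bracket. -/
lemma kernel_le_rescaled_bracket {E : Type*} [NormedAddCommGroup E] [NormedSpace ℝ E]
    {a η lam s t : ℝ} (ha : 0 ≤ a + η) (hs : 0 < s) (ht : 0 < t) {u w : E}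
    (hw : ‖w‖ < t) (hu : s ≤ ‖u‖) :
    t ^ η * (t + dist u w) ^ (-(a + η)) * (1 + ‖u‖ / s) ^ lam ≤
      t ^ η * (s / 2) ^ (-(a + η)) * (1 + ‖s⁻¹ • u‖) ^ (-(a + η - lam)) := by
  have hnorm : ‖s⁻¹ • u‖ = ‖u‖ / s := by
    rw [norm_smul, norm_inv, Real.norm_of_nonneg hs.le, div_eq_inv_mul]
  have hpos : 0 < 1 + ‖u‖ / s := by positivity
  have htri : ‖u‖ ≤ t + dist u w := by
    have h := norm_le_norm_add_norm_sub' u w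
    rw [dist_eq_norm]
    linarith
  have hlow : s / 2 * (1 + ‖u‖ / s) ≤ t + dist u w := by
    have h : s / 2 * (1 + ‖u‖ / s) = (s + ‖u‖) / 2 := by field_simp
    linarith
  have hexp : -(a + η - lam) = -(a + η) + lam := by ring
  rw [hnorm, hexp, Real.rpow_add hpos, ← mul_assoc, mul_assoc (t ^ η) ((s / 2) ^ _),
    ← Real.mul_rpow (by positivity) hpos.le]
  gcongr _ * ?_ * _
  exact Real.rpow_le_rpow_of_nonpos (by positivity) hlow (neg_nonpos.2 ha)

/-- Estimate (4.6): for `0 < s < t` and `|w| < t`, the exterior integral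
`∫_{|u| ≥ s} t^η (t+|u-w|)^{-(n+η)} (1+|u|/s)^λ du` is bounded by `C (t/s)^η`, with `C`
depending only on `n`, `λ` and `η`. -/
theorem stmt6 (n : ℕ) (hn : 1 ≤ n) (lam η : ℝ) (hlam : 0 ≤ lam) (hlη : lam < η) :
    ∃ C : ℝ, 0 < C ∧
      ∀ s t : ℝ, 0 < s → s < t →
        ∀ w : EuclideanSpace ℝ (Fin n), ‖w‖ < t →
          ∫⁻ u in {u : EuclideanSpace ℝ (Fin n) | s ≤ ‖u‖},
              ENNReal.ofReal (t ^ η * (t + dist u w) ^ (-((n : ℝ) + η)) *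
                (1 + ‖u‖ / s) ^ lam) ≤
            ENNReal.ofReal (C * (t / s) ^ η) := by
  let f : EuclideanSpace ℝ (Fin n) → ℝ := fun v ↦ (1 + ‖v‖) ^ (-((n : ℝ) + η - lam))
  have hf : Integrable f := integrable_one_add_norm (by
    rw [finrank_euclideanSpace_fin]
    linarith)
  have hf0 : ∀ v, 0 ≤ f v := fun v ↦ by positivity
  have hI : 0 ≤ ∫ v, f v := integral_nonneg hf0
  refine ⟨2 ^ ((n : ℝ) + η) * ((∫ v, f v) + 1), by positivity, fun s t hs hst w hw ↦ ?_⟩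
  have ht : 0 < t := hs.trans hst
  have hη : 0 ≤ (n : ℝ) + η := by
    have : (0 : ℝ) ≤ n := n.cast_nonneg
    linarith
  set A : ℝ := t ^ η * (s / 2) ^ (-((n : ℝ) + η)) with hA
  have hA0 : 0 ≤ A := by positivity
  have hscale : A * s ^ n = 2 ^ ((n : ℝ) + η) * (t / s) ^ η := by
    rw [hA, Real.rpow_neg (by positivity), Real.div_rpow hs.le zero_le_two,
      Real.div_rpow ht.le hs.le, Real.rpow_add hs, Real.rpow_natCast]
    field_simp
  calc
    _ ≤ ∫⁻ u in {u : EuclideanSpace ℝ (Fin n) | s ≤ ‖u‖}, ENNReal.ofReal (A * f (s⁻¹ • u)) :=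
      setLIntegral_mono' (measurableSet_le measurable_const measurable_norm) fun u hu ↦
        ENNReal.ofReal_le_ofReal (kernel_le_rescaled_bracket hη hs ht hw hu)
    _ ≤ ∫⁻ u, ENNReal.ofReal (A * f (s⁻¹ • u)) := setLIntegral_le_lintegral _ _
    _ = ENNReal.ofReal (∫ u, A * f (s⁻¹ • u)) :=
      (ofReal_integral_eq_lintegral_ofReal ((hf.comp_smul (inv_ne_zero hs.ne')).const_mul A)
        (Filter.Eventually.of_forall fun u ↦ mul_nonneg hA0 (hf0 _))).symm
    _ ≤ _ := by
      refine ENNReal.ofReal_le_ofReal ?_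
      rw [integral_const_mul, Measure.integral_comp_inv_smul_of_nonneg _ _ hs.le,
        finrank_euclideanSpace_fin, smul_eq_mul, ← mul_assoc, hscale, mul_right_comm]
      gcongr
      linarith
end

section
/- Let n ≥ 1, let O ⊆ ℝⁿ, and let Q be the closed cube with center c ∈ ℝⁿ and side length ℓ > 0, i.e. Q = {z ∈ ℝⁿ : |z_k - c_k| ≤ ℓ/2 for all k}. Suppose the dilated cube 5Q = {z : |z_k - c_k| ≤ 5ℓ/2 for all k} meets the complement of O. If (y,t) ∈ ℝⁿ × (0,∞) satisfies that the open ball B(y, 4√n t) is contained in O and y + 3t·ē ∈ Q (where ē = (1,…,1)), then t ≤ 3ℓ and moreover |y_k - c_k| ≤ 10ℓ for all k (i.e. y ∈ 20Q). -/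
open MeasureTheory

/-- The vector `ē = (1,…,1)` in `ℝⁿ`. -/
noncomputable def allOnes (n : ℕ) : EuclideanSpace ℝ (Fin n) :=
  (WithLp.equiv 2 (Fin n → ℝ)).symm (fun _ => 1)

/-- If all coordinate differences are at most `r`, the Euclidean distance is at most `√n r`. -/
theorem EuclideanSpace.dist_le_sqrt_mul {n : ℕ} {x y : EuclideanSpace ℝ (Fin n)} {r : ℝ}
    (hr : 0 ≤ r) (h : ∀ k, |x k - y k| ≤ r) : dist x y ≤ √n * r := by
  rw [EuclideanSpace.dist_eq]
  refine Real.sqrt_le_iff.mpr ⟨by positivity, ?_⟩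
  calc ∑ k, dist (x k) (y k) ^ 2 ≤ ∑ _k : Fin n, r ^ 2 :=
        Finset.sum_le_sum fun k _ => pow_le_pow_left₀ dist_nonneg (h k) 2
    _ = (√n * r) ^ 2 := by simp [mul_pow]

/-- Localization of the atoms: if `Q` is a cube of side `ℓ` whose dilate `5Q` meets `Oᶜ`,
`B(y, 4√n t) ⊆ O` and `y + 3t·ē ∈ Q`, then `t ≤ 3ℓ` and `y ∈ 20Q`. -/
theorem stmt9 (n : ℕ) (hn : 1 ≤ n) (O : Set (EuclideanSpace ℝ (Fin n)))
    (c : EuclideanSpace ℝ (Fin n)) (ℓ : ℝ) (hℓ : 0 < ℓ)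
    (hWhitney : ∃ z : EuclideanSpace ℝ (Fin n),
      (∀ k : Fin n, |z k - c k| ≤ 5 * ℓ / 2) ∧ z ∉ O)
    (y : EuclideanSpace ℝ (Fin n)) (t : ℝ) (ht : 0 < t)
    (hball : Metric.ball y (4 * Real.sqrt n * t) ⊆ O)
    (hmem : ∀ k : Fin n, |(y + (3 * t) • allOnes n) k - c k| ≤ ℓ / 2) :
    t ≤ 3 * ℓ ∧ ∀ k : Fin n, |y k - c k| ≤ 10 * ℓ := by
  obtain ⟨z, hz, hzO⟩ := hWhitney
  have hy (k : Fin n) : |y k + 3 * t - c k| ≤ ℓ / 2 := by simpa [allOnes] using hmem k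
  have hzy : dist z y ≤ √n * (3 * ℓ + 3 * t) := by
    refine EuclideanSpace.dist_le_sqrt_mul (by positivity) fun k => ?_
    have h₁ := abs_le.mp (hz k)
    have h₂ := abs_le.mp (hy k)
    exact abs_le.mpr ⟨by linarith, by linarith⟩
  have hfar : 4 * √n * t ≤ dist z y := not_lt.mp fun h => hzO (hball (Metric.mem_ball.mpr h))
  have hsqrt : 0 < √(n : ℝ) := Real.sqrt_pos.mpr (Nat.cast_pos.mpr hn)
  have hle : 4 * t ≤ 3 * ℓ + 3 * t := le_of_mul_le_mul_left (by linarith) hsqrt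
  refine ⟨by linarith, fun k => ?_⟩
  have h := abs_le.mp (hy k)
  exact abs_le.mpr ⟨by linarith, by linarith⟩
end
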